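/- arXiv:1903.12641 — 3 statements merged into one kernel-verified Lean document; each statement's English description precedes it below -/
import Mathlib

section
/- Let G = (V, E) be a finite connected simple graph, let v ∈ V, and suppose V ∖ {v} is partitioned into two nonempty sets A and B such that no edge of G joins a vertex of A to a vertex of B (so G is the 1-sum, at v, of the induced subgraphs G₁ = G[A ∪ {v}] and G₂ = G[B ∪ {v}]). Then the set of connected cuts of G is the union of the set of connected cuts of G₁ and the set of connected cuts of G₂: C(G) = C(G₁) ∪ C(G₂), where each connected cut is regarded as a set of edges. -/
/-- The cut `δ(U)`: the set of edges of `G` with exactly one endpoint in `U`. -/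
def cut {V : Type*} (G : SimpleGraph V) (U : Set V) : Set (Sym2 V) :=
  {e | e ∈ G.edgeSet ∧ ∃ a b, e = s(a, b) ∧ a ∈ U ∧ b ∉ U}

/-- The set of connected cuts of `G`. -/
def connectedCuts {V : Type*} (G : SimpleGraph V) : Set (Set (Sym2 V)) :=
  {F | ∃ U : Set V, U.Nonempty ∧ Uᶜ.Nonempty ∧
    (G.induce U).Connected ∧ (G.induce Uᶜ).Connected ∧ F = cut G U}

/-- A surjection that sends adjacent vertices to reachable ones preserves connectedness. -/
theorem SimpleGraph.Connected.of_surjective_of_adj_reachable {V W : Type*} {G : SimpleGraph V}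
    {H : SimpleGraph W} (hG : G.Connected) (f : V → W) (hf : Function.Surjective f)
    (hadj : ∀ a b, G.Adj a b → H.Reachable (f a) (f b)) : H.Connected := by
  have key : ∀ a b, H.Reachable (f a) (f b) := fun a b => by
    obtain ⟨p⟩ := hG.preconnected a b
    induction p with
    | nil => exact .rfl
    | cons h _ ih => exact (hadj _ _ h).trans ih
  have := hG.nonempty.map f
  refine SimpleGraph.Connected.mk fun x y => ?_
  obtain ⟨a, rfl⟩ := hf x
  obtain ⟨b, rfl⟩ := hf y
  exact key a b

/-- Inducing twice is inducing on the image. -/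
theorem SimpleGraph.connected_induce_induce {V : Type*} (G : SimpleGraph V) (S : Set V)
    (X : Set S) :
    ((G.induce S).induce X).Connected ↔ (G.induce (Subtype.val '' X)).Connected := by
  let e : (G.induce S).induce X ≃g G.induce (Subtype.val '' X) :=
    { toEquiv := Equiv.Set.image Subtype.val X Subtype.val_injective
      map_rel_iff' := Iff.rfl }
  exact e.connected_iff

/-- A set that is connected in `G` and contained in the union of two sets without edges between
them is contained in one of the two. -/
theorem SimpleGraph.Connected.subset_or_subset_of_not_adj {V : Type*} {G : SimpleGraph V}
    {W A B : Set V} (hW : (G.induce W).Connected) (hWAB : W ⊆ A ∪ B)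
    (hsep : ∀ a ∈ A, ∀ b ∈ B, ¬ G.Adj a b) : W ⊆ A ∨ W ⊆ B := by
  by_contra! h
  obtain ⟨y, hy, hyA⟩ := Set.not_subset.1 h.1
  obtain ⟨x, hx, hxB⟩ := Set.not_subset.1 h.2
  have hxA : x ∈ A := (hWAB hx).resolve_right hxB
  have key : ∀ a b : W, (G.induce W).Reachable a b → a.1 ∈ A → b.1 ∈ A := fun a b hab => by
    obtain ⟨p⟩ := hab
    induction p with
    | nil => exact id
    | @cons u w _ hadj _ ih =>
      exact fun hu => ih ((hWAB w.2).resolve_right fun hw => hsep _ hu _ hw hadj)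
  exact hyA (key ⟨x, hx⟩ ⟨y, hy⟩ (hW.preconnected _ _) hxA)

theorem cut_compl {V : Type*} (G : SimpleGraph V) (U : Set V) : cut G Uᶜ = cut G U := by
  ext e
  constructor
  · rintro ⟨he, a, b, rfl, ha, hb⟩
    exact ⟨he, b, a, Sym2.eq_swap, not_not.1 hb, ha⟩
  · rintro ⟨he, a, b, rfl, ha, hb⟩
    exact ⟨he, b, a, Sym2.eq_swap, hb, not_not.2 ha⟩

/-- Every connected cut is given by a side that avoids a prescribed vertex. -/
theorem mem_connectedCuts_iff_notMem {V : Type*} (G : SimpleGraph V) (v : V)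
    (F : Set (Sym2 V)) :
    F ∈ connectedCuts G ↔ ∃ W : Set V, v ∉ W ∧ (G.induce W).Connected ∧
      (G.induce Wᶜ).Connected ∧ F = cut G W := by
  constructor
  · rintro ⟨U, -, -, hU, hUc, rfl⟩
    by_cases hv : v ∈ U
    · exact ⟨Uᶜ, not_not.2 hv, hUc, by rwa [compl_compl], (cut_compl G U).symm⟩
    · exact ⟨U, hv, hU, hUc, rfl⟩
  · rintro ⟨W, hv, hW, hWc, rfl⟩
    exact ⟨W, Set.nonempty_coe_sort.1 hW.nonempty, ⟨v, hv⟩, hW, hWc, rfl⟩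

/-- If all neighbours of `W ⊆ S` lie in `S`, the cut of `W` in `G` is its cut in `G[S]`. -/
theorem image_cut_induce {V : Type*} (G : SimpleGraph V) {S W : Set V} (hWS : W ⊆ S)
    (hnbr : ∀ a ∈ W, ∀ b, G.Adj a b → b ∈ S) :
    Sym2.map (Subtype.val : S → V) '' cut (G.induce S) (Subtype.val ⁻¹' W) = cut G W := by
  ext e
  constructor
  · rintro ⟨_, ⟨he, a, b, rfl, ha, hb⟩, rfl⟩
    exact ⟨he, a, b, rfl, ha, hb⟩
  · rintro ⟨he, a, b, rfl, ha, hb⟩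
    exact ⟨s(⟨a, hWS ha⟩, ⟨b, hnbr a ha b he⟩), ⟨he, _, _, rfl, ha, hb⟩, rfl⟩

/-- Collapsing `B` to the cut vertex `v` preserves connectedness of sets containing `v`. -/
theorem SimpleGraph.Connected.induce_inter_of_cutVertex {V : Type*} {G : SimpleGraph V} {v : V}
    {A B : Set V} (hpart : A ∪ B = ({v} : Set V)ᶜ)
    (hsep : ∀ a ∈ A, ∀ b ∈ B, ¬ G.Adj a b) {U : Set V} (hv : v ∈ U)
    (hU : (G.induce U).Connected) : (G.induce (U ∩ (A ∪ {v}))).Connected := by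
  classical
  have hcover : ∀ x, x ∉ A ∪ {v} → x ∈ B := fun x hx => by
    have : x ∈ A ∪ B := hpart ▸ fun h => hx (Or.inr h)
    exact this.resolve_left fun h => hx (Or.inl h)
  have hnbr : ∀ x y, x ∈ A ∪ {v} → y ∉ A ∪ {v} → G.Adj x y → x = v := fun x y hx hy h =>
    hx.resolve_left fun hxA => hsep x hxA y (hcover y hy) h
  let f : U → (U ∩ (A ∪ {v}) : Set V) := fun x =>
    if h : x.1 ∈ A ∪ {v} then ⟨x, x.2, h⟩ else ⟨v, hv, Or.inr rfl⟩
  refine hU.of_surjective_of_adj_reachable f (fun x => ⟨⟨x, x.2.1⟩, ?_⟩) fun a b hab => ?_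
  · exact dif_pos x.2.2
  · by_cases ha : a.1 ∈ A ∪ {v} <;> by_cases hb : b.1 ∈ A ∪ {v} <;>
      simp only [f, dif_pos, dif_neg, ha, hb, not_false_eq_true]
    · exact SimpleGraph.Adj.reachable hab
    · simp only [hnbr _ _ ha hb hab]; exact .rfl
    · simp only [hnbr _ _ hb ha hab.symm]; exact .rfl
    · exact .rfl

/-- In a 1-sum at `v`, the connected cuts of the summand `G[A ∪ {v}]` are the connected cuts of
`G` with a side contained in `A`. -/
theorem mem_image_connectedCuts_iff {V : Type*} {G : SimpleGraph V} (hG : G.Connected)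
    {v : V} {A B : Set V} (hpart : A ∪ B = ({v} : Set V)ᶜ) (hdisj : Disjoint A B)
    (hsep : ∀ a ∈ A, ∀ b ∈ B, ¬ G.Adj a b) (F : Set (Sym2 V)) :
    F ∈ (fun F => Sym2.map (Subtype.val : (A ∪ {v} : Set V) → V) '' F) ''
          connectedCuts (G.induce (A ∪ {v})) ↔
      ∃ W : Set V, W ⊆ A ∧ (G.induce W).Connected ∧ (G.induce Wᶜ).Connected ∧
        F = cut G W := by
  have hvA : v ∉ A := fun h => (hpart ▸ Or.inl h : v ∈ ({v} : Set V)ᶜ) rfl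
  have hcover : ∀ x, x ∉ A → x ≠ v → x ∈ B := fun x hx hxv =>
    (hpart ▸ hxv : x ∈ A ∪ B).resolve_left hx
  have hcut : ∀ W ⊆ A, Sym2.map (Subtype.val : (A ∪ {v} : Set V) → V) ''
      cut (G.induce (A ∪ {v})) (Subtype.val ⁻¹' W) = cut G W := fun W hW =>
    image_cut_induce G (hW.trans Set.subset_union_left) fun a ha b hab => by
      by_contra hb
      exact hsep a (hW ha) b
        (hcover b (fun h => hb (Or.inl h)) fun h => hb (Or.inr h)) hab
  have hside : ∀ W ⊆ A, ((G.induce (A ∪ {v})).induce (Subtype.val ⁻¹' W)).Connected ↔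
      (G.induce W).Connected := fun W hW => by
    rw [SimpleGraph.connected_induce_induce, Subtype.image_preimage_coe,
      Set.inter_eq_right.2 (hW.trans Set.subset_union_left)]
  have hrest : ∀ W ⊆ A, ((G.induce (A ∪ {v})).induce (Subtype.val ⁻¹' W)ᶜ).Connected ↔
      (G.induce Wᶜ).Connected := fun W hW => by
    rw [SimpleGraph.connected_induce_induce, ← Set.preimage_compl, Subtype.image_preimage_coe,
      Set.inter_comm]
    refine ⟨fun h => ?_, fun h => h.induce_inter_of_cutVertex hpart hsep fun hv => hvA (hW hv)⟩
    have hT : (G.induce (Set.univ ∩ (B ∪ {v}))).Connected :=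
      SimpleGraph.Connected.induce_inter_of_cutVertex (by rw [Set.union_comm, hpart])
        (fun b hb a ha hab => hsep a ha b hb hab.symm) (Set.mem_univ v)
        (G.induceUnivIso.connected_iff.2 hG)
    have hunion := SimpleGraph.induce_union_connected h.preconnected hT.preconnected
      ⟨v, ⟨fun hv => hvA (hW hv), Or.inr rfl⟩, trivial, Or.inr rfl⟩
    have hWc : Wᶜ ∩ (A ∪ {v}) ∪ Set.univ ∩ (B ∪ {v}) = Wᶜ := by
      refine Set.Subset.antisymm (fun x hx => ?_) fun x hx => ?_
      · rintro hxW
        rcases hx with hx | ⟨-, hx | rfl⟩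
        · exact hx.1 hxW
        · exact Set.disjoint_left.1 hdisj (hW hxW) hx
        · exact hvA (hW hxW)
      · by_cases hxA : x ∈ A
        · exact Or.inl ⟨hx, Or.inl hxA⟩
        · by_cases hxv : x = v
          · exact Or.inr ⟨trivial, Or.inr hxv⟩
          · exact Or.inr ⟨trivial, Or.inl (hcover x hxA hxv)⟩
    rwa [hWc] at hunion
  constructor
  · rintro ⟨_, hF, rfl⟩
    obtain ⟨X, hvX, hX, hXc, rfl⟩ :=
      (mem_connectedCuts_iff_notMem _ ⟨v, Or.inr rfl⟩ _).1 hF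
    obtain ⟨W, hWA, rfl⟩ : ∃ W ⊆ A, X = Subtype.val ⁻¹' W := by
      refine ⟨Subtype.val '' X, ?_, (Set.preimage_image_eq X Subtype.val_injective).symm⟩
      rintro _ ⟨⟨x, hx⟩, hxX, rfl⟩
      refine hx.resolve_right ?_
      rintro rfl
      exact hvX hxX
    exact ⟨W, hWA, (hside W hWA).1 hX, (hrest W hWA).1 hXc, hcut W hWA⟩
  · rintro ⟨W, hWA, hW, hWc, rfl⟩
    exact ⟨_, (mem_connectedCuts_iff_notMem _ ⟨v, Or.inr rfl⟩ _).2
      ⟨_, fun hv => hvA (hWA hv), (hside W hWA).2 hW, (hrest W hWA).2 hWc, rfl⟩, hcut W hWA⟩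

/-- If a connected graph `G` is the 1-sum at `v` of `G₁ = G[A ∪ {v}]` and `G₂ = G[B ∪ {v}]`
(where `A, B` partition `V ∖ {v}` into nonempty parts with no edges between them), then the
connected cuts of `G` are exactly the connected cuts of `G₁` together with those of `G₂`,
each regarded as a set of edges of `G`. -/
theorem connectedCuts_one_sum {V : Type*} [Fintype V] (G : SimpleGraph V) (hG : G.Connected)
    (v : V) (A B : Set V) (hpart : A ∪ B = ({v} : Set V)ᶜ) (hdisj : Disjoint A B)
    (hA : A.Nonempty) (hB : B.Nonempty)
    (hsep : ∀ a ∈ A, ∀ b ∈ B, ¬ G.Adj a b) :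
    connectedCuts G =
      (fun F => Sym2.map (Subtype.val : (A ∪ {v} : Set V) → V) '' F) ''
          connectedCuts (G.induce (A ∪ {v})) ∪
        (fun F => Sym2.map (Subtype.val : (B ∪ {v} : Set V) → V) '' F) ''
          connectedCuts (G.induce (B ∪ {v})) := by
  have hpart' : B ∪ A = ({v} : Set V)ᶜ := by rw [Set.union_comm, hpart]
  have hsep' : ∀ b ∈ B, ∀ a ∈ A, ¬ G.Adj b a := fun b hb a ha hab => hsep a ha b hb hab.symm
  have hv : v ∉ A ∪ B := by simp [hpart]
  ext F
  rw [Set.mem_union, mem_image_connectedCuts_iff hG hpart hdisj hsep,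
    mem_image_connectedCuts_iff hG hpart' hdisj.symm hsep', mem_connectedCuts_iff_notMem G v]
  constructor
  · rintro ⟨W, hvW, hW, hWc, rfl⟩
    have hWAB : W ⊆ A ∪ B := hpart ▸ Set.subset_compl_singleton_iff.2 hvW
    exact (hW.subset_or_subset_of_not_adj hWAB hsep).imp
      (fun h => ⟨W, h, hW, hWc, rfl⟩) fun h => ⟨W, h, hW, hWc, rfl⟩
  · rintro (⟨W, hWs, h⟩ | ⟨W, hWs, h⟩)
    · exact ⟨W, fun hvW => hv (Or.inl (hWs hvW)), h⟩
    · exact ⟨W, fun hvW => hv (Or.inr (hWs hvW)), h⟩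
end

section
/- Let G = (V, E) be a finite connected simple graph, let u, v be distinct vertices of G, and suppose V ∖ {u, v} is partitioned into two sets A and B such that no edge of G joins a vertex of A to a vertex of B. Let U ⊆ V with u ∈ U and v ∉ U. Then δ(U) is a connected cut of G (i.e. G[U] and G[V∖U] are both connected) if and only if the four induced subgraphs G[(U ∩ A) ∪ {u}], G[(U ∩ B) ∪ {u}], G[(A ∖ U) ∪ {v}], and G[(B ∖ U) ∪ {v}] are all connected. -/
/-- If `G[S]` is connected, `c ∈ T ⊆ S`, and every edge of `G[S]` leaving `T` starts at `c`,
then `G[T]` is connected. -/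
theorem SimpleGraph.Connected.induce_of_cut_vertex {V : Type*} {G : SimpleGraph V} {S T : Set V}
    {c : V} (hS : (G.induce S).Connected) (hTS : T ⊆ S) (hc : c ∈ T)
    (hT : ∀ x ∈ T, x ≠ c → ∀ y ∈ S, G.Adj x y → y ∈ T) : (G.induce T).Connected := by
  classical
  let f : S → T := fun x => if h : (x : V) ∈ T then ⟨x, h⟩ else ⟨c, hc⟩
  have hf (x : V) (hx : x ∈ T) : f ⟨x, hTS hx⟩ = ⟨x, hx⟩ := dif_pos hx
  have hstep (x y : S) (hxy : (G.induce S).Adj x y) : (G.induce T).Reachable (f x) (f y) := by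
    have hadj : G.Adj x y := hxy
    by_cases hx : (x : V) ∈ T <;> by_cases hy : (y : V) ∈ T
    · simp only [f, dif_pos hx, dif_pos hy]
      exact SimpleGraph.Adj.reachable (G := G.induce T) hadj
    · have hxc : (x : V) = c := by_contra fun h => hy (hT x hx h y y.2 hadj)
      simp [f, hy, hxc, hc]
    · have hyc : (y : V) = c := by_contra fun h => hx (hT y hy h x x.2 hadj.symm)
      simp [f, hx, hyc, hc]
    · simp [f, hx, hy]
  have hwalk {x y : S} (p : (G.induce S).Walk x y) : (G.induce T).Reachable (f x) (f y) := by
    induction p with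
    | nil => exact .refl _
    | cons h _ ih => exact (hstep _ _ h).trans ih
  refine (SimpleGraph.connected_iff _).2 ⟨?_, ⟨⟨c, hc⟩⟩⟩
  rintro ⟨x, hx⟩ ⟨y, hy⟩
  obtain ⟨p⟩ := hS.preconnected ⟨x, hTS hx⟩ ⟨y, hTS hy⟩
  simpa only [hf x hx, hf y hy] using hwalk p

/-- If no edge joins `C` to `D`, then `G[C ∪ D ∪ {c}]` is connected iff `G[C ∪ {c}]` and
`G[D ∪ {c}]` are. -/
theorem SimpleGraph.connected_induce_iff_of_cut_vertex {V : Type*} {G : SimpleGraph V}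
    {S C D : Set V} {c : V} (hS : S = (C ∪ {c}) ∪ (D ∪ {c}))
    (hCD : ∀ x ∈ C, ∀ y ∈ D, ¬ G.Adj x y) :
    (G.induce S).Connected ↔ (G.induce (C ∪ {c})).Connected ∧ (G.induce (D ∪ {c})).Connected := by
  subst hS
  constructor
  · intro h
    constructor
    · refine h.induce_of_cut_vertex Set.subset_union_left (c := c) (by simp) ?_
      rintro x (hx | hx) hxc y (hy | hy | hy) hxy
      exacts [hy, (hCD x hx y hy hxy).elim, .inr hy, hy, (hxc hx).elim, .inr hy]
    · refine h.induce_of_cut_vertex Set.subset_union_right (c := c) (by simp) ?_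
      rintro x (hx | hx) hxc y ((hy | hy) | hy) hxy
      exacts [(hCD y hy x hx hxy.symm).elim, .inr hy, hy, (hxc hx).elim, .inr hy, hy]
  · rintro ⟨h₁, h₂⟩
    exact SimpleGraph.induce_union_connected h₁.preconnected h₂.preconnected
      ⟨c, by simp, by simp⟩


/-- Let `G` be a finite connected graph, `u ≠ v` vertices, and let `A, B` partition
`V ∖ {u, v}` with no edge joining `A` to `B`. For `U ⊆ V` with `u ∈ U` and `v ∉ U`,
`δ(U)` is a connected cut (i.e. `G[U]` and `G[Uᶜ]` are connected) iff the four induced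
subgraphs `G[(U ∩ A) ∪ {u}]`, `G[(U ∩ B) ∪ {u}]`, `G[(A ∖ U) ∪ {v}]`, `G[(B ∖ U) ∪ {v}]`
are all connected. -/
theorem connected_cut_two_sum_iff {V : Type*} [Fintype V] (G : SimpleGraph V)
    (hG : G.Connected) (u v : V) (huv : u ≠ v) (A B : Set V)
    (hpart : A ∪ B = ({u, v} : Set V)ᶜ) (hdisj : Disjoint A B)
    (hsep : ∀ a ∈ A, ∀ b ∈ B, ¬ G.Adj a b)
    (U : Set V) (hu : u ∈ U) (hv : v ∉ U) :
    ((G.induce U).Connected ∧ (G.induce Uᶜ).Connected) ↔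
      ((G.induce ((U ∩ A) ∪ {u})).Connected ∧
       (G.induce ((U ∩ B) ∪ {u})).Connected ∧
       (G.induce ((A \ U) ∪ {v})).Connected ∧
       (G.induce ((B \ U) ∪ {v})).Connected) := by
  have hmem (x : V) : x ∈ A ∨ x ∈ B ↔ ¬ (x = u ∨ x = v) := Set.ext_iff.1 hpart x
  have hU : U = ((U ∩ A) ∪ {u}) ∪ ((U ∩ B) ∪ {u}) := by
    ext x
    have := hmem x
    simp only [Set.mem_union, Set.mem_inter_iff, Set.mem_singleton_iff]
    grind
  have hUc : Uᶜ = ((A \ U) ∪ {v}) ∪ ((B \ U) ∪ {v}) := by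
    ext x
    have := hmem x
    simp only [Set.mem_union, Set.mem_sdiff, Set.mem_compl_iff, Set.mem_singleton_iff]
    grind
  have h₁ := SimpleGraph.connected_induce_iff_of_cut_vertex (G := G) hU
    fun a ha b hb => hsep a ha.2 b hb.2
  have h₂ := SimpleGraph.connected_induce_iff_of_cut_vertex (G := G) hUc
    fun a ha b hb => hsep a ha.1 b hb.1
  rw [h₁, h₂, and_assoc]
end

section
/- Let G = (V, E) be a finite connected simple graph, let u, v be distinct vertices of G, and suppose V ∖ {u, v} is partitioned into two sets A and B such that no edge of G joins a vertex of A to a vertex of B. Suppose U, U' ⊆ V are such that δ(U) and δ(U') are connected cuts of G with u ∈ U, u ∈ U', v ∉ U, and v ∉ U'. Then the 'mixed' set W = {u} ∪ (U ∩ A) ∪ (U' ∩ B) also yields a connected cut δ(W) of G with u ∈ W and v ∉ W. -/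
/-- If `S` induces a connected subgraph and the only way to leave `C` inside `S` is through `r`,
then every vertex of `S ∩ C` can be joined to `r` inside any `T ⊇ S ∩ C` containing `r`. -/
theorem SimpleGraph.Connected.reachable_induce_of_exit {V : Type*} {G : SimpleGraph V}
    {S C T : Set V} {r : V} (hS : (G.induce S).Connected) (hrS : r ∈ S)
    (hC : ∀ x ∈ S ∩ C, ∀ y ∈ S, G.Adj x y → y ∈ C ∨ y = r)
    (hT : S ∩ C ⊆ T) (hrT : r ∈ T) {x : V} (hxT : x ∈ T) (hxS : x ∈ S)
    (hxC : x ∈ C) :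
    (G.induce T).Reachable ⟨x, hxT⟩ ⟨r, hrT⟩ := by
  have key : ∀ (a b : S), (G.induce S).Walk a b → b.1 = r → ∀ ha : a.1 ∈ C,
      (G.induce T).Reachable ⟨a.1, hT ⟨a.2, ha⟩⟩ ⟨r, hrT⟩ := by
    intro a b p
    induction p with
    | nil =>
      rintro rfl _
      exact SimpleGraph.Reachable.refl _
    | @cons a c b h p ih =>
      intro hb ha
      have hac : G.Adj a.1 c.1 := h
      rcases hC a.1 ⟨a.2, ha⟩ c.1 c.2 hac with hc | hc
      · have hadj : (G.induce T).Adj ⟨a.1, hT ⟨a.2, ha⟩⟩ ⟨c.1, hT ⟨c.2, hc⟩⟩ := hac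
        exact hadj.reachable.trans (ih hb hc)
      · have hadj : (G.induce T).Adj ⟨a.1, hT ⟨a.2, ha⟩⟩ ⟨r, hrT⟩ := by
          simpa [hc] using hac
        exact hadj.reachable
  obtain ⟨p⟩ := hS.preconnected ⟨x, hxS⟩ ⟨r, hrS⟩
  exact key _ _ p rfl hxC

/-- A graph in which every vertex can be joined to `r` is connected. -/
theorem SimpleGraph.connected_of_forall_reachable {V : Type*} {G : SimpleGraph V} (r : V)
    (h : ∀ x, G.Reachable x r) : G.Connected :=
  have : Nonempty V := ⟨r⟩
  ⟨fun x y => (h x).trans (h y).symm⟩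

/-- Let `G` be a finite connected graph, `u ≠ v`, and `A, B` partition `V ∖ {u, v}` with
no edge joining `A` to `B`. If `δ(U)` and `δ(U')` are connected cuts with
`u ∈ U, U'` and `v ∉ U, U'`, then the mixed set `W = {u} ∪ (U ∩ A) ∪ (U' ∩ B)` also
yields a connected cut `δ(W)` with `u ∈ W` and `v ∉ W`. -/
theorem mixed_connected_cut {V : Type*} [Fintype V] (G : SimpleGraph V)
    (hG : G.Connected) (u v : V) (huv : u ≠ v) (A B : Set V)
    (hpart : A ∪ B = ({u, v} : Set V)ᶜ) (hdisj : Disjoint A B)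
    (hsep : ∀ a ∈ A, ∀ b ∈ B, ¬ G.Adj a b)
    (U U' : Set V) (hu : u ∈ U) (hu' : u ∈ U') (hv : v ∉ U) (hv' : v ∉ U')
    (hU1 : (G.induce U).Connected) (hU2 : (G.induce Uᶜ).Connected)
    (hU'1 : (G.induce U').Connected) (hU'2 : (G.induce U'ᶜ).Connected) :
    (G.induce ({u} ∪ (U ∩ A) ∪ (U' ∩ B))).Connected ∧
      (G.induce ({u} ∪ (U ∩ A) ∪ (U' ∩ B))ᶜ).Connected ∧
      u ∈ ({u} ∪ (U ∩ A) ∪ (U' ∩ B) : Set V) ∧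
      v ∉ ({u} ∪ (U ∩ A) ∪ (U' ∩ B) : Set V) := by
  have hmem : ∀ x, x ∈ A ∨ x ∈ B ↔ x ≠ u ∧ x ≠ v := fun x => by
    simpa using Set.ext_iff.mp hpart x
  have hAB : ∀ x ∈ A, x ∉ B := fun _ hx => Set.disjoint_left.mp hdisj hx
  have hA : ∀ x ∈ A, ∀ y, G.Adj x y → y ∈ A ∨ y = u ∨ y = v := fun x hx y hxy => by
    have := hsep x hx y
    have := hmem y
    tauto
  have hB : ∀ x ∈ B, ∀ y, G.Adj x y → y ∈ B ∨ y = u ∨ y = v := fun x hx y hxy => by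
    have : y ∈ A → ¬ G.Adj y x := fun hy => hsep y hy x hx
    have := hmem y
    have := hxy.symm
    tauto
  have huW : u ∈ ({u} ∪ (U ∩ A) ∪ (U' ∩ B) : Set V) := Or.inl (Or.inl rfl)
  have hvW : v ∉ ({u} ∪ (U ∩ A) ∪ (U' ∩ B) : Set V) := by
    rintro ((h | h) | h)
    · exact huv h.symm
    · exact hv h.1
    · exact hv' h.1
  refine ⟨?_, ?_, huW, hvW⟩
  · refine SimpleGraph.connected_of_forall_reachable ⟨u, huW⟩ ?_
    rintro ⟨x, (rfl | ⟨hxU, hxA⟩) | ⟨hxU, hxB⟩⟩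
    · exact SimpleGraph.Reachable.refl _
    · refine hU1.reachable_induce_of_exit hu (C := A) ?_ (fun y hy => Or.inl (Or.inr hy)) huW
        (Or.inl (Or.inr ⟨hxU, hxA⟩)) hxU hxA
      rintro a ⟨-, ha⟩ y hy hay
      rcases hA a ha y hay with h | h | rfl
      exacts [Or.inl h, Or.inr h, absurd hy hv]
    · refine hU'1.reachable_induce_of_exit hu' (C := B) ?_ (fun y hy => Or.inr hy) huW
        (Or.inr ⟨hxU, hxB⟩) hxU hxB
      rintro a ⟨-, ha⟩ y hy hay
      rcases hB a ha y hay with h | h | rfl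
      exacts [Or.inl h, Or.inr h, absurd hy hv']
  · refine SimpleGraph.connected_of_forall_reachable ⟨v, hvW⟩ ?_
    rintro ⟨x, hx⟩
    by_cases hxv : x = v
    · subst hxv
      exact SimpleGraph.Reachable.refl _
    have hxu : x ≠ u := fun h => hx (Or.inl (Or.inl h))
    rcases (hmem x).2 ⟨hxu, hxv⟩ with hxA | hxB
    · refine hU2.reachable_induce_of_exit hv (C := A) ?_ ?_ hvW hx
        (fun h => hx (Or.inl (Or.inr ⟨h, hxA⟩))) hxA
      · rintro a ⟨-, ha⟩ y hy hay
        rcases hA a ha y hay with h | rfl | h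
        exacts [Or.inl h, absurd hu hy, Or.inr h]
      · rintro y ⟨hyU, hyA⟩ ((h | h) | h)
        · exact ((hmem y).1 (Or.inl hyA)).1 h
        · exact hyU h.1
        · exact hAB y hyA h.2
    · refine hU'2.reachable_induce_of_exit hv' (C := B) ?_ ?_ hvW hx
        (fun h => hx (Or.inr ⟨h, hxB⟩)) hxB
      · rintro a ⟨-, ha⟩ y hy hay
        rcases hB a ha y hay with h | rfl | h
        exacts [Or.inl h, absurd hu' hy, Or.inr h]
      · rintro y ⟨hyU, hyB⟩ ((h | h) | h)
        · exact ((hmem y).1 (Or.inr hyB)).1 h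
        · exact hAB y h.2 hyB
        · exact hyU h.1
end
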